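/- arXiv:1308.6607 — 2 statements merged into one kernel-verified Lean document; each statement's English description precedes it below -/
import Mathlib

section
/- Let H₁, H₂, H₃ ∈ (1/2, 1) with H₁ + H₂ + H₃ > 2, set κ̄ = H₁ + H₂ + H₃ − 2, let T > 0, let f(z) = |z₁|^{2H₁−2}|z₂|^{2H₂−2}|z₃|^{2H₃−2}, and let 0 < ρ₁ < min(2H₁−1, 2H₂−1, 2H₃−1, 2κ̄). Then there exists a constant C > 0 such that for all 0 < h ≤ 1, ∫₀^T ∫_{S²} ∫_{S²} |f(s(ξ+η) + h(ξ+η)) − f(s(ξ+η) + hη)| s σ(dξ) σ(dη) ds ≤ C h^{ρ₁}. -/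
open MeasureTheory Real
open scoped ENNReal

noncomputable section

abbrev E3 : Type := EuclideanSpace ℝ (Fin 3)

/-- The fractional covariance kernel `f(z) = |z₁|^{2H₁-2} |z₂|^{2H₂-2} |z₃|^{2H₃-2}`. -/
def fracKernel (H₁ H₂ H₃ : ℝ) (z : E3) : ℝ :=
  |z 0| ^ (2 * H₁ - 2) * |z 1| ^ (2 * H₂ - 2) * |z 2| ^ (2 * H₃ - 2)

/-- Uniform surface measure on the unit sphere `S²` in `ℝ³` (total mass `4 π`),
viewed as a measure on `ℝ³`. -/
def sphereMeasure : Measure E3 :=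
  Measure.map (fun x : Metric.sphere (0 : E3) 1 => (x : E3)) ((volume : Measure E3).toSphere)

instance instContinuousStarE3 : ContinuousStar (E3 →L[ℝ] E3) :=
  ⟨(ContinuousLinearMap.adjoint (𝕜 := ℝ) (E := E3) (F := E3)).continuous⟩

instance instCompactSpaceUnitaryE3 : CompactSpace (unitary (E3 →L[ℝ] E3)) := by
  refine isCompact_iff_compactSpace.mp ?_
  refine Metric.isCompact_of_isClosed_isBounded isClosed_unitary ?_
  refine (Metric.isBounded_closedBall (x := (0 : E3 →L[ℝ] E3)) (r := 1)).subset fun u hu => ?_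
  rw [mem_closedBall_zero_iff]
  refine ContinuousLinearMap.opNorm_le_bound _ zero_le_one fun x => ?_
  rw [one_mul]
  exact (Unitary.norm_map ⟨u, hu⟩ x).le

instance instIsFiniteMeasureSphereMeasure : IsFiniteMeasure sphereMeasure := by
  unfold sphereMeasure; infer_instance

lemma sphereMeasure_ne_zero : sphereMeasure ≠ 0 := by
  unfold sphereMeasure
  rw [Ne, Measure.map_eq_zero_iff (by fun_prop)]
  exact Measure.toSphere_ne_zero _

lemma ae_norm_eq_one : ∀ᵐ x ∂sphereMeasure, ‖x‖ = 1 := by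
  unfold sphereMeasure
  rw [ae_map_iff (by fun_prop) (measurableSet_eq_fun (by fun_prop) (by fun_prop))]
  exact .of_forall fun x => by simp

open scoped Pointwise in
lemma sphereMeasure_apply {s : Set E3} (hs : MeasurableSet s) :
    sphereMeasure s
      = 3 * volume (Set.Ioo (0 : ℝ) 1 • (s ∩ Metric.sphere (0 : E3) 1)) := by
  unfold sphereMeasure
  rw [Measure.map_apply (by fun_prop) hs, Measure.toSphere_apply' _ (hs.preimage (by fun_prop)),
    Subtype.image_preimage_coe, Set.inter_comm]
  simp

open scoped Pointwise in
lemma measurePreserving_sphereMeasure (e : E3 ≃ₗᵢ[ℝ] E3) :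
    MeasurePreserving e sphereMeasure sphereMeasure := by
  refine ⟨by fun_prop, Measure.ext fun s hs => ?_⟩
  have hm : Measurable e := by fun_prop
  rw [Measure.map_apply hm hs, sphereMeasure_apply hs, sphereMeasure_apply (hm hs)]
  congr 1
  rw [← (LinearIsometryEquiv.measurePreserving e).measure_preimage_emb
    e.toHomeomorph.measurableEmbedding (Set.Ioo (0 : ℝ) 1 • (s ∩ Metric.sphere 0 1))]
  congr 1
  ext x
  simp only [Set.mem_smul, Set.mem_inter_iff, Set.mem_preimage, mem_sphere_zero_iff_norm]
  constructor
  · rintro ⟨r, hr, y, ⟨hy, hy'⟩, rfl⟩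
    exact ⟨r, hr, e y, ⟨hy, by simpa using hy'⟩, by simp⟩
  · rintro ⟨r, hr, y, ⟨hy, hy'⟩, h⟩
    refine ⟨r, hr, e.symm y, ⟨by simpa using hy, by simpa using hy'⟩, ?_⟩
    apply e.injective
    simp [h]

/-- The product kernel `∏ |zᵢ|^{-bᵢ}` with values in `[0, ∞]`. -/
def powKernel (b : Fin 3 → ℝ) (z : E3) : ℝ≥0∞ := ∏ i, ‖z i‖ₑ ^ (-b i)

@[fun_prop]
lemma measurable_powKernel (b : Fin 3 → ℝ) : Measurable (powKernel b) := by
  unfold powKernel; fun_prop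

lemma powKernel_smul (b : Fin 3 → ℝ) {c : ℝ} (hc : 0 < c) (z : E3) :
    powKernel b (c • z) = ENNReal.ofReal c ^ (-∑ i, b i) * powKernel b z := by
  have h0 : ENNReal.ofReal c ≠ 0 := by simpa using hc
  have h1 : ∀ i, ‖(c • z) i‖ₑ ^ (-b i) = ENNReal.ofReal c ^ (-b i) * ‖z i‖ₑ ^ (-b i) := by
    intro i
    rw [PiLp.smul_apply, enorm_smul, Real.enorm_of_nonneg hc.le,
      ENNReal.mul_rpow_of_ne_top ENNReal.ofReal_ne_top enorm_ne_top]
  unfold powKernel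
  simp_rw [h1, Finset.prod_mul_distrib]
  congr 1
  rw [Fin.prod_univ_three, Fin.sum_univ_three, ← ENNReal.rpow_add _ _ h0 ENNReal.ofReal_ne_top,
    ← ENNReal.rpow_add _ _ h0 ENNReal.ofReal_ne_top]
  congr 1; ring

lemma lintegral_sphereMeasure_le {F : E3 → ℝ≥0∞} (hF : Measurable F)
    (hmono : ∀ r : ℝ, 0 < r → r < 1 → ∀ x, F x ≤ F (r • x)) :
    ∫⁻ x, F x ∂sphereMeasure ≤ 3 * ∫⁻ x in Metric.ball (0 : E3) 1, F x := by
  let J : Set (Set.Ioi (0 : ℝ)) := Set.Iio ⟨1, Set.mem_Ioi.2 one_pos⟩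
  have hJ : MeasurableSet J := measurableSet_Iio
  have hfin : Module.finrank ℝ E3 = 3 := by simp
  have hmp := Measure.measurePreserving_homeomorphUnitSphereProd (volume : Measure E3)
  rw [hfin] at hmp
  have h1 : ∫⁻ p, F (p.1 : E3) * J.indicator 1 p.2
      ∂((volume : Measure E3).toSphere.prod (Measure.volumeIoiPow 2))
      = (∫⁻ x, F x ∂sphereMeasure) * ENNReal.ofReal (1 / 3) := by
    rw [lintegral_prod_mul (f := fun p : Metric.sphere (0 : E3) 1 => F (p : E3))
      (g := J.indicator 1) (by fun_prop) ((measurable_one.indicator hJ).aemeasurable),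
      lintegral_indicator_one hJ, Measure.volumeIoiPow_apply_Iio, sphereMeasure,
      lintegral_map hF (by fun_prop)]
    norm_num
  have h2 : ∫⁻ p, F (p.1 : E3) * J.indicator 1 p.2
      ∂((volume : Measure E3).toSphere.prod (Measure.volumeIoiPow 2))
      ≤ ∫⁻ x in Metric.ball (0 : E3) 1, F x := by
    rw [← hmp.lintegral_comp_emb (homeomorphUnitSphereProd E3).measurableEmbedding]
    calc _ ≤ ∫⁻ x : ({0}ᶜ : Set E3), (Metric.ball (0 : E3) 1).indicator F x
            ∂(Measure.comap Subtype.val volume) := by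
          refine lintegral_mono fun x => ?_
          have hx : 0 < ‖(x : E3)‖ := norm_pos_iff.2 x.2
          have hJx : (homeomorphUnitSphereProd E3 x).2 ∈ J ↔ ‖(x : E3)‖ < 1 := by
            rw [Set.mem_Iio, ← Subtype.coe_lt_coe, homeomorphUnitSphereProd_apply_snd_coe]
          by_cases hx1 : ‖(x : E3)‖ < 1
          · rw [Set.indicator_of_mem (hJx.2 hx1),
              Set.indicator_of_mem (by simpa using hx1)]
            have := hmono _ hx hx1 (‖(x : E3)‖⁻¹ • (x : E3))
            rw [smul_smul, mul_inv_cancel₀ hx.ne', one_smul] at this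
            simpa using this
          · rw [Set.indicator_of_notMem (mt hJx.1 hx1)]
            simp
      _ = ∫⁻ x in ({0}ᶜ : Set E3), (Metric.ball (0 : E3) 1).indicator F x :=
          lintegral_subtype_comap (measurableSet_singleton _).compl _
      _ ≤ ∫⁻ x, (Metric.ball (0 : E3) 1).indicator F x := setLIntegral_le_lintegral _ _
      _ = _ := lintegral_indicator measurableSet_ball _
  rw [h1] at h2
  calc _ = 3 * ((∫⁻ x, F x ∂sphereMeasure) * ENNReal.ofReal (1 / 3)) := by
        rw [mul_comm, mul_assoc, show (3 : ℝ≥0∞) = ENNReal.ofReal 3 by simp,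
          ← ENNReal.ofReal_mul (by norm_num)]
        norm_num
    _ ≤ _ := by gcongr

lemma lintegral_fin_prod {n : ℕ} {g : Fin n → ℝ → ℝ≥0∞} (hg : ∀ i, Measurable (g i)) :
    ∫⁻ x : Fin n → ℝ, ∏ i, g i (x i) = ∏ i, ∫⁻ x, g i x := by
  induction n with
  | zero => simp [lintegral_unique, volume_pi]
  | succ n ih =>
    rw [← (volume_preserving_piFinSuccAbove (fun _ => ℝ) 0).symm.lintegral_comp_emb
      (MeasurableEquiv.measurableEmbedding _)]
    simp only [MeasurableEquiv.piFinSuccAbove_symm_apply, Fin.insertNthEquiv,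
      Fin.prod_univ_succ, Fin.insertNth_zero, Equiv.coe_fn_mk, Fin.cons_succ, Fin.cons_zero,
      Fin.zero_succAbove, cast_eq]
    have h0 := hg 0
    have h1 : ∀ i : Fin n, Measurable (g i.succ) := fun i => hg i.succ
    rw [Measure.volume_eq_prod,
      lintegral_prod_mul (f := g 0) (g := fun y : Fin n → ℝ => ∏ i, g i.succ (y i))
      h0.aemeasurable
      (Finset.measurable_prod _ fun i _ => (h1 i).comp (measurable_pi_apply i)).aemeasurable, ih h1]

lemma lintegral_enorm_rpow_neg_lt_top {b : ℝ} (hb : b < 1) :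
    ∫⁻ x in Metric.ball (0 : ℝ) 1, ‖x‖ₑ ^ (-b) < ⊤ := by
  have h : IntegrableOn (fun x : ℝ => ‖x‖ ^ (-b)) (Metric.ball 0 1) volume := by
    rw [integrableOn_fun_norm_addHaar volume (f := fun x => x ^ (-b))]
    have := (intervalIntegral.intervalIntegrable_rpow' (a := 0) (b := 1) (r := -b) (by linarith)).1
    simpa using this.mono_set Set.Ioo_subset_Ioc_self
  refine lt_of_le_of_lt (le_of_eq ?_) h.2
  refine lintegral_congr_ae (ae_restrict_of_ae ?_)
  filter_upwards [Measure.ae_ne volume (0 : ℝ)] with x hx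
  have : 0 < ‖x‖ := norm_pos_iff.2 hx
  rw [Real.enorm_of_nonneg (r := ‖x‖ ^ (-b)) (by positivity),
    ← ENNReal.ofReal_rpow_of_pos this, ofReal_norm]

lemma lintegral_ball_powKernel_lt_top {b : Fin 3 → ℝ} (hb : ∀ i, b i < 1) :
    ∫⁻ x in Metric.ball (0 : E3) 1, powKernel b x < ⊤ := by
  let g : Fin 3 → ℝ → ℝ≥0∞ := fun i => (Metric.ball (0 : ℝ) 1).indicator fun x => ‖x‖ₑ ^ (-b i)
  have hg : ∀ i, Measurable (g i) := fun i =>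
    Measurable.indicator (by fun_prop) measurableSet_ball
  have h1 : ∀ i, ∫⁻ x, g i x < ⊤ := fun i => by
    rw [lintegral_indicator measurableSet_ball fun x => ‖x‖ₑ ^ (-b i)]
    exact lintegral_enorm_rpow_neg_lt_top (hb i)
  calc _ = ∫⁻ x, (Metric.ball (0 : E3) 1).indicator (powKernel b) x :=
        (lintegral_indicator measurableSet_ball (powKernel b)).symm
    _ ≤ ∫⁻ x : E3, ∏ i, g i (x i) := by
        refine lintegral_mono (Set.indicator_le fun y hy => ?_)
        refine le_of_eq (Finset.prod_congr rfl fun i _ => ?_)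
        have hyi : y i ∈ Metric.ball (0 : ℝ) 1 := by
          rw [mem_ball_zero_iff] at hy ⊢
          exact (PiLp.norm_apply_le y i).trans_lt hy
        exact (Set.indicator_of_mem hyi fun x : ℝ => ‖x‖ₑ ^ (-b i)).symm
    _ = ∫⁻ x : Fin 3 → ℝ, ∏ i, g i (x i) := by
        rw [← (PiLp.volume_preserving_toLp (Fin 3)).lintegral_comp_emb
          (MeasurableEquiv.toLp 2 (Fin 3 → ℝ)).measurableEmbedding]
    _ = ∏ i, ∫⁻ x, g i x := by
        exact lintegral_fin_prod hg
    _ < ⊤ := ENNReal.prod_lt_top fun i _ => h1 i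

lemma lintegral_powKernel_lt_top {b : Fin 3 → ℝ} (hb0 : ∀ i, 0 ≤ b i) (hb : ∀ i, b i < 1) :
    ∫⁻ x, powKernel b x ∂sphereMeasure < ⊤ := by
  refine (lintegral_sphereMeasure_le (measurable_powKernel b) fun r hr hr1 x => ?_).trans_lt
    (ENNReal.mul_lt_top ENNReal.ofNat_lt_top (lintegral_ball_powKernel_lt_top hb))
  rw [powKernel_smul b hr]
  refine le_mul_of_one_le_left zero_le ?_
  rw [ENNReal.ofReal_rpow_of_pos hr, ENNReal.one_le_ofReal]
  exact Real.one_le_rpow_of_pos_of_le_one_of_nonpos hr hr1.le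
    (neg_nonpos.2 (Finset.sum_nonneg fun i _ => hb0 i))

lemma exists_isometry_apply_eq {v w : E3} (h : ‖v‖ = ‖w‖) : ∃ e : E3 ≃ₗᵢ[ℝ] E3, e v = w :=
  ⟨_, Submodule.reflection_sub h⟩

lemma abs_mul_abs_le_norm_add_sq {ξ : E3} (hξ : ‖ξ‖ = 1) :
    |ξ 0| * |ξ 1| ≤ ‖ξ + EuclideanSpace.single 2 1‖ ^ 2 := by
  have h1 : ξ 0 ^ 2 + ξ 1 ^ 2 + ξ 2 ^ 2 = 1 := by
    have := EuclideanSpace.norm_sq_eq ξ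
    rw [hξ, Fin.sum_univ_three] at this
    simpa using this.symm
  have h2 : ‖ξ + EuclideanSpace.single 2 1‖ ^ 2 = 2 * (1 + ξ 2) := by
    rw [EuclideanSpace.norm_sq_eq, Fin.sum_univ_three]
    simp
    linarith
  rw [h2]
  have h3 : ξ 2 ^ 2 ≤ 1 := by nlinarith [sq_nonneg (ξ 0), sq_nonneg (ξ 1)]
  have h4 : |ξ 2| ≤ 1 := abs_le_one_iff_mul_self_le_one.2 (by nlinarith)
  have h5 := abs_le.1 h4
  have h6 : |ξ 0| * |ξ 1| ≤ (ξ 0 ^ 2 + ξ 1 ^ 2) / 2 := by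
    nlinarith [sq_nonneg (|ξ 0| - |ξ 1|), sq_abs (ξ 0), sq_abs (ξ 1)]
  nlinarith

lemma exists_lintegral_norm_add_rpow_le {B : ℝ} (hB0 : 0 ≤ B) (hB : B < 2) :
    ∃ C : ℝ≥0∞, C ≠ ⊤ ∧ ∀ η : E3, ‖η‖ = 1 →
      ∫⁻ ξ, ‖ξ + η‖ₑ ^ (-B) ∂sphereMeasure ≤ C := by
  let b : Fin 3 → ℝ := ![B / 2, B / 2, 0]
  refine ⟨∫⁻ x, powKernel b x ∂sphereMeasure, (lintegral_powKernel_lt_top ?_ ?_).ne,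
    fun η hη => ?_⟩
  · intro i; fin_cases i <;> simp [b] <;> linarith
  · intro i; fin_cases i <;> simp [b] <;> linarith
  obtain ⟨e, he⟩ := exists_isometry_apply_eq
    (v := EuclideanSpace.single 2 (1 : ℝ)) (w := η) (by simp [hη])
  rw [← (measurePreserving_sphereMeasure e).lintegral_comp_emb
    e.toHomeomorph.measurableEmbedding]
  refine lintegral_mono_ae ?_
  filter_upwards [ae_norm_eq_one] with ξ hξ
  rw [← he, ← map_add, LinearIsometryEquiv.enorm_map]
  have h := abs_mul_abs_le_norm_add_sq hξ
  have h' : ‖ξ 0‖ₑ * ‖ξ 1‖ₑ ≤ ‖ξ + EuclideanSpace.single 2 1‖ₑ ^ (2 : ℝ) := by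
    rw [← ofReal_norm, ← ofReal_norm, ← ofReal_norm, ← ENNReal.ofReal_mul (norm_nonneg _),
      ENNReal.ofReal_rpow_of_nonneg (norm_nonneg _) (by norm_num)]
    exact ENNReal.ofReal_le_ofReal (by simpa using h)
  calc _ = (‖ξ + EuclideanSpace.single 2 1‖ₑ ^ (2 : ℝ)) ^ (-(B / 2)) := by
        rw [← ENNReal.rpow_mul]; congr 1; ring
    _ ≤ (‖ξ 0‖ₑ * ‖ξ 1‖ₑ) ^ (-(B / 2)) := by
        rw [ENNReal.rpow_neg, ENNReal.rpow_neg]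
        gcongr
    _ = _ := by
        rw [ENNReal.mul_rpow_of_ne_top enorm_ne_top enorm_ne_top]
        simp [powKernel, Fin.prod_univ_three, b]

lemma mul_norm_add_sq_le {α β : ℝ} {ξ η : E3} (hξ : ‖ξ‖ = 1)
    (hη : ‖η‖ = 1) : α * β * ‖ξ + η‖ ^ 2 ≤ ‖α • ξ + β • η‖ ^ 2 := by
  rw [norm_add_sq_real, norm_add_sq_real, inner_smul_left, inner_smul_right, norm_smul, norm_smul,
    hξ, hη]
  simp
  nlinarith [sq_nonneg (α - β)]

/-- The average of `powKernel b` over all rotations of a vector is dominated by a radial power. -/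
lemma exists_lintegral_haar_powKernel_le {b : Fin 3 → ℝ} (hb0 : ∀ i, 0 < b i)
    (hb : ∀ i, b i < 1) :
    ∃ A : ℝ≥0∞, A ≠ ⊤ ∧ ∀ w : E3,
      ∫⁻ g : unitary (E3 →L[ℝ] E3), powKernel b (((g⁻¹ : unitary (E3 →L[ℝ] E3)) : E3 →L[ℝ] E3) w)
        ∂Measure.haar ≤ A * ‖w‖ₑ ^ (-∑ i, b i) := by
  let U := unitary (E3 →L[ℝ] E3)
  let M : E3 → ℝ≥0∞ := fun w => ∫⁻ g : U, powKernel b (((g⁻¹ : U) : E3 →L[ℝ] E3) w) ∂Measure.haar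
  let e₀ : E3 := EuclideanSpace.single 2 1
  have he₀ : ‖e₀‖ = 1 := by simp [e₀]
  have hB : 0 < ∑ i, b i := Finset.sum_pos (fun i _ => hb0 i) Finset.univ_nonempty
  have hcont : Continuous fun p : U × E3 => ((p.1⁻¹ : U) : E3 →L[ℝ] E3) p.2 :=
    (continuous_subtype_val.comp continuous_fst.inv).clm_apply continuous_snd
  have hM : ∀ w, ‖w‖ = 1 → M w = M e₀ := by
    intro w hw
    obtain ⟨e, he⟩ := exists_isometry_apply_eq (he₀.trans hw.symm)
    let u : U := Unitary.linearIsometryEquiv.symm e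
    have hu : (u : E3 →L[ℝ] E3) e₀ = w := he
    simp only [M]
    rw [← lintegral_mul_left_eq_self _ u]
    refine lintegral_congr fun g => ?_
    rw [mul_inv_rev, ← hu, ← mul_apply_eq_comp, ← Submonoid.coe_mul,
      inv_mul_cancel_right]
  have hMe : M e₀ ≠ ⊤ := by
    have h1 : ∫⁻ w, M w ∂sphereMeasure = M e₀ * sphereMeasure Set.univ := by
      rw [← lintegral_const]
      refine lintegral_congr_ae ?_
      filter_upwards [ae_norm_eq_one] with w hw using hM w hw
    have h2 : ∫⁻ w, M w ∂sphereMeasure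
        = (∫⁻ x, powKernel b x ∂sphereMeasure) * (Measure.haar : Measure U) Set.univ := by
      simp only [M]
      rw [lintegral_lintegral_swap, ← lintegral_const]
      · refine lintegral_congr fun g => ?_
        exact (measurePreserving_sphereMeasure
          (Unitary.linearIsometryEquiv g⁻¹)).lintegral_comp (measurable_powKernel b)
      · exact ((measurable_powKernel b).comp
          (hcont.comp continuous_swap).measurable).aemeasurable
    intro h
    rw [h1, h, ENNReal.top_mul (by simpa using sphereMeasure_ne_zero)] at h2
    exact (ENNReal.mul_lt_top (lintegral_powKernel_lt_top (fun i => (hb0 i).le) hb)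
      (measure_lt_top _ _)).ne h2.symm
  refine ⟨M e₀ + 1, by simpa using hMe, fun w => ?_⟩
  rcases eq_or_ne w 0 with rfl | hw
  · simp [ENNReal.zero_rpow_of_neg (neg_lt_zero.2 hB)]
  have hw' : 0 < ‖w‖ := norm_pos_iff.2 hw
  have h3 : ∀ g : U, powKernel b (((g⁻¹ : U) : E3 →L[ℝ] E3) w)
      = ‖w‖ₑ ^ (-∑ i, b i) * powKernel b (((g⁻¹ : U) : E3 →L[ℝ] E3) (‖w‖⁻¹ • w)) := by
    intro g
    rw [← ofReal_norm, ← powKernel_smul b hw', ← map_smul, smul_smul, mul_inv_cancel₀ hw'.ne',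
      one_smul]
  have h4 : Measurable fun g : U => powKernel b (((g⁻¹ : U) : E3 →L[ℝ] E3) (‖w‖⁻¹ • w)) :=
    (measurable_powKernel b).comp (hcont.comp (by fun_prop :
      Continuous fun g : U => (g, ‖w‖⁻¹ • w))).measurable
  calc _ = ‖w‖ₑ ^ (-∑ i, b i) * M (‖w‖⁻¹ • w) := by
        rw [← lintegral_const_mul _ h4]
        exact lintegral_congr h3
    _ = M e₀ * ‖w‖ₑ ^ (-∑ i, b i) := by
        rw [hM _ (by rw [norm_smul, norm_inv, norm_norm, inv_mul_cancel₀ hw'.ne']), mul_comm]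
    _ ≤ _ := by gcongr; exact le_self_add

lemma measure_mul_eq_lintegral_lintegral_lintegral {U : Type*} [MeasurableSpace U]
    {μ : Measure U} [SFinite μ] {Q : U × E3 → ℝ≥0∞} (hQ : Measurable Q) (α β : ℝ) {K : ℝ≥0∞}
    (hK : ∀ g, ∫⁻ ξ, ∫⁻ η, Q (g, α • ξ + β • η) ∂sphereMeasure ∂sphereMeasure = K) :
    μ Set.univ * K
      = ∫⁻ ξ, ∫⁻ η, ∫⁻ g, Q (g, α • ξ + β • η) ∂μ ∂sphereMeasure ∂sphereMeasure := by
  calc _ = ∫⁻ g, ∫⁻ ξ, ∫⁻ η, Q (g, α • ξ + β • η) ∂sphereMeasure ∂sphereMeasure ∂μ := by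
        simp_rw [hK, lintegral_const]
        rw [mul_comm]
    _ = ∫⁻ ξ, ∫⁻ g, ∫⁻ η, Q (g, α • ξ + β • η) ∂sphereMeasure ∂μ ∂sphereMeasure := by
        refine lintegral_lintegral_swap (Measurable.aemeasurable ?_)
        exact Measurable.lintegral_prod_right'
          (f := fun p : (U × E3) × E3 => Q (p.1.1, α • p.1.2 + β • p.2)) (by fun_prop)
    _ = _ := by
        refine lintegral_congr fun ξ => lintegral_lintegral_swap (Measurable.aemeasurable ?_)
        exact hQ.comp (by fun_prop : Measurable fun p : U × E3 => (p.1, α • ξ + β • p.2))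

lemma haar_mul_lintegral_lintegral_powKernel (b : Fin 3 → ℝ) (α β : ℝ) :
    (Measure.haar : Measure (unitary (E3 →L[ℝ] E3))) Set.univ *
        ∫⁻ ξ, ∫⁻ η, powKernel b (α • ξ + β • η) ∂sphereMeasure ∂sphereMeasure
      = ∫⁻ ξ, ∫⁻ η, ∫⁻ g : unitary (E3 →L[ℝ] E3),
          powKernel b (((g⁻¹ : unitary (E3 →L[ℝ] E3)) : E3 →L[ℝ] E3) (α • ξ + β • η))
        ∂Measure.haar ∂sphereMeasure ∂sphereMeasure := by
  let U := unitary (E3 →L[ℝ] E3)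
  have hinv : ∀ g : U,
      ∫⁻ ξ, ∫⁻ η, powKernel b (((g⁻¹ : U) : E3 →L[ℝ] E3) (α • ξ + β • η))
        ∂sphereMeasure ∂sphereMeasure
      = ∫⁻ ξ, ∫⁻ η, powKernel b (α • ξ + β • η) ∂sphereMeasure ∂sphereMeasure := by
    intro g
    let e : E3 ≃ₗᵢ[ℝ] E3 := Unitary.linearIsometryEquiv g⁻¹
    have he := measurePreserving_sphereMeasure e
    have heq : ∀ x, ((g⁻¹ : U) : E3 →L[ℝ] E3) x = e x := fun _ => rfl
    simp only [heq, map_add, map_smul]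
    rw [← he.lintegral_comp (f := fun ξ => ∫⁻ η, powKernel b (α • ξ + β • η) ∂sphereMeasure)
      (Measurable.lintegral_prod_right' (f := fun p : E3 × E3 => powKernel b (α • p.1 + β • p.2))
        (by fun_prop))]
    refine lintegral_congr fun ξ => ?_
    exact he.lintegral_comp (f := fun η => powKernel b (α • e ξ + β • η)) (by fun_prop)
  have hcont : Continuous fun p : U × E3 => ((p.1⁻¹ : U) : E3 →L[ℝ] E3) p.2 :=
    (continuous_subtype_val.comp continuous_fst.inv).clm_apply continuous_snd
  have hmeas : Measurable fun p : U × E3 => powKernel b (((p.1⁻¹ : U) : E3 →L[ℝ] E3) p.2) :=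
    (measurable_powKernel b).comp hcont.measurable
  exact measure_mul_eq_lintegral_lintegral_lintegral hmeas α β hinv

lemma enorm_add_rpow_le {α β B : ℝ} (hα : 0 < α) (hβ : 0 < β) (hB0 : 0 < B) {ξ η : E3}
    (hξ : ‖ξ‖ = 1) (hη : ‖η‖ = 1) :
    ‖α • ξ + β • η‖ₑ ^ (-B) ≤ ENNReal.ofReal (α * β) ^ (-B / 2) * ‖η + ξ‖ₑ ^ (-B) := by
  have h1 : ENNReal.ofReal (α * β) * ‖η + ξ‖ₑ ^ (2 : ℝ) ≤ ‖α • ξ + β • η‖ₑ ^ (2 : ℝ) := by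
    rw [← ofReal_norm, ← ofReal_norm,
      ENNReal.ofReal_rpow_of_nonneg (norm_nonneg _) (by norm_num),
      ENNReal.ofReal_rpow_of_nonneg (norm_nonneg _) (by norm_num),
      ← ENNReal.ofReal_mul (by positivity), add_comm η]
    exact ENNReal.ofReal_le_ofReal (by simpa using mul_norm_add_sq_le hξ hη)
  calc _ = (‖α • ξ + β • η‖ₑ ^ (2 : ℝ)) ^ (-(B / 2)) := by
        rw [← ENNReal.rpow_mul]; congr 1; ring
    _ ≤ (ENNReal.ofReal (α * β) * ‖η + ξ‖ₑ ^ (2 : ℝ)) ^ (-(B / 2)) := by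
        rw [ENNReal.rpow_neg, ENNReal.rpow_neg]
        gcongr
    _ = _ := by
        rw [ENNReal.mul_rpow_of_ne_top ENNReal.ofReal_ne_top
          (ENNReal.rpow_ne_top_of_nonneg (by norm_num) enorm_ne_top), ← ENNReal.rpow_mul]
        congr 2 <;> ring

lemma exists_lintegral_lintegral_powKernel_le {b : Fin 3 → ℝ} (hb0 : ∀ i, 0 < b i)
    (hb : ∀ i, b i < 1) (hB : ∑ i, b i < 2) :
    ∃ D : ℝ≥0∞, D ≠ ⊤ ∧ ∀ α β : ℝ, 0 < α → 0 < β →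
      ∫⁻ ξ, ∫⁻ η, powKernel b (α • ξ + β • η) ∂sphereMeasure ∂sphereMeasure
        ≤ D * ENNReal.ofReal (α * β) ^ (-(∑ i, b i) / 2) := by
  let U := unitary (E3 →L[ℝ] E3)
  set B := ∑ i, b i with hBdef
  have hB0 : 0 < B := Finset.sum_pos (fun i _ => hb0 i) Finset.univ_nonempty
  obtain ⟨A, hA, hAle⟩ := exists_lintegral_haar_powKernel_le hb0 hb
  obtain ⟨C, hC, hCle⟩ := exists_lintegral_norm_add_rpow_le hB0.le hB
  let m : ℝ≥0∞ := (Measure.haar : Measure U) Set.univ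
  have hm : m ≠ ⊤ := measure_ne_top _ _
  have hm0 : m ≠ 0 := by simp [m, NeZero.ne]
  refine ⟨m⁻¹ * (A * (C * sphereMeasure Set.univ)), ?_, fun α β hα hβ => ?_⟩
  · exact ENNReal.mul_ne_top (ENNReal.inv_ne_top.2 hm0)
      (ENNReal.mul_ne_top hA (ENNReal.mul_ne_top hC (measure_ne_top _ _)))
  have hmain : m * ∫⁻ ξ, ∫⁻ η, powKernel b (α • ξ + β • η) ∂sphereMeasure ∂sphereMeasure
      ≤ A * (ENNReal.ofReal (α * β) ^ (-B / 2) * (C * sphereMeasure Set.univ)) := by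
    rw [haar_mul_lintegral_lintegral_powKernel]
    calc _ ≤ ∫⁻ ξ, A * (ENNReal.ofReal (α * β) ^ (-B / 2) * C) ∂sphereMeasure := by
          refine lintegral_mono_ae ?_
          filter_upwards [ae_norm_eq_one] with ξ hξ
          calc _ ≤ ∫⁻ η, A * (ENNReal.ofReal (α * β) ^ (-B / 2) * ‖η + ξ‖ₑ ^ (-B))
                ∂sphereMeasure := by
                refine lintegral_mono_ae ?_
                filter_upwards [ae_norm_eq_one] with η hη
                exact (hAle _).trans (mul_le_mul_right (enorm_add_rpow_le hα hβ hB0 hξ hη) A)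
            _ = A * (ENNReal.ofReal (α * β) ^ (-B / 2) *
                  ∫⁻ η, ‖η + ξ‖ₑ ^ (-B) ∂sphereMeasure) := by
                rw [lintegral_const_mul _ (by fun_prop), lintegral_const_mul _ (by fun_prop)]
            _ ≤ _ := by gcongr; exact hCle ξ hξ
      _ = _ := by rw [lintegral_const]; ring
  calc _ = m⁻¹ * (m * ∫⁻ ξ, ∫⁻ η, powKernel b (α • ξ + β • η)
        ∂sphereMeasure ∂sphereMeasure) := by
        rw [← mul_assoc, ENNReal.inv_mul_cancel hm0 hm, one_mul]
    _ ≤ m⁻¹ * (A * (ENNReal.ofReal (α * β) ^ (-B / 2) * (C * sphereMeasure Set.univ))) := by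
        gcongr
    _ = _ := by ring

lemma one_sub_div_rpow_le {x y δ a ρ : ℝ} (hx : 0 < x) (hy : 0 < y) (hxy : |x - y| ≤ δ)
    (ha0 : 0 ≤ a) (ha : a ≤ 1) (hρ : 0 ≤ ρ) (hρ1 : ρ ≤ 1) :
    1 - (x / y) ^ a ≤ (δ / x) ^ ρ := by
  have hδ : 0 ≤ δ := (abs_nonneg _).trans hxy
  have hR : 0 ≤ (δ / x) ^ ρ := by positivity
  rcases le_or_gt y x with h | h
  · have : 1 ≤ (x / y) ^ a := Real.one_le_rpow ((one_le_div hy).2 h) ha0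
    linarith
  · have ht0 : 0 < x / y := by positivity
    have ht1 : x / y < 1 := (div_lt_one hy).2 h
    have h1 : x / y ≤ (x / y) ^ a := by
      simpa using Real.rpow_le_rpow_of_exponent_ge ht0 ht1.le ha
    have h2 : 1 - x / y ≤ (1 - x / y) ^ ρ := by
      simpa using Real.rpow_le_rpow_of_exponent_ge (x := 1 - x / y) (by linarith) (by linarith) hρ1
    have h3 : 1 - x / y ≤ δ / x := by
      rw [one_sub_div hy.ne']
      exact div_le_div₀ hδ (by linarith [neg_abs_le (x - y)]) hx h.le
    linarith [Real.rpow_le_rpow (by linarith) h3 hρ]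

lemma one_sub_prod_three_le {r c : Fin 3 → ℝ} (hr : ∀ i, 0 ≤ r i) (hc : ∀ i, 0 ≤ c i)
    (h : ∀ i, 1 - r i ≤ c i) : 1 - ∏ i, r i ≤ ∑ i, c i := by
  have h1 : ∏ i, min (r i) 1 ≤ ∏ i, r i :=
    Finset.prod_le_prod (fun i _ => le_min (hr i) zero_le_one) fun i _ => min_le_left _ _
  have h2 : ∀ i, 1 - min (r i) 1 ≤ c i := fun i => by
    rcases min_choice (r i) 1 with h' | h' <;> rw [h'] <;> linarith [h i, hc i]
  have h3 : ∀ i, min (r i) 1 ≤ 1 := fun i => min_le_right _ _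
  have h4 : ∀ i, 0 ≤ min (r i) 1 := fun i => le_min (hr i) zero_le_one
  rw [Fin.prod_univ_three] at h1
  rw [Fin.sum_univ_three]
  have := mul_le_one₀ (h3 0) (h4 1) (h3 1)
  nlinarith [h2 0, h2 1, h2 2, mul_nonneg (sub_nonneg.2 (h3 0)) (sub_nonneg.2 (h3 1)),
    mul_nonneg (sub_nonneg.2 this) (sub_nonneg.2 (h3 2))]

lemma prod_rpow_sub_prod_rpow_le {x y a : Fin 3 → ℝ} {δ ρ : ℝ} (hx : ∀ i, 0 < x i)
    (hy : ∀ i, 0 < y i) (hxy : ∀ i, |x i - y i| ≤ δ) (ha0 : ∀ i, 0 ≤ a i) (ha : ∀ i, a i ≤ 1)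
    (hρ : 0 ≤ ρ) (hρ1 : ρ ≤ 1) :
    ∏ i, x i ^ (-a i) - ∏ i, y i ^ (-a i)
      ≤ δ ^ ρ * ∑ j, x j ^ (-ρ) * ∏ i, x i ^ (-a i) := by
  have hδ : 0 ≤ δ := (abs_nonneg _).trans (hxy 0)
  have h1 : ∏ i, y i ^ (-a i) = (∏ i, x i ^ (-a i)) * ∏ i, (x i / y i) ^ a i := by
    rw [← Finset.prod_mul_distrib]
    refine Finset.prod_congr rfl fun i _ => ?_
    rw [Real.div_rpow (hx i).le (hy i).le, Real.rpow_neg (hx i).le, Real.rpow_neg (hy i).le]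
    have := Real.rpow_pos_of_pos (hx i) (a i)
    field_simp
  have h2 := one_sub_prod_three_le (r := fun i => (x i / y i) ^ a i) (c := fun i => (δ / x i) ^ ρ)
    (fun i => Real.rpow_nonneg (div_pos (hx i) (hy i)).le _)
    (fun i => Real.rpow_nonneg (div_nonneg hδ (hx i).le) _)
    (fun i => one_sub_div_rpow_le (hx i) (hy i) (hxy i) (ha0 i) (ha i) hρ hρ1)
  have h3 : 0 ≤ ∏ i, x i ^ (-a i) := Finset.prod_nonneg fun i _ => Real.rpow_nonneg (hx i).le _
  calc _ = (∏ i, x i ^ (-a i)) * (1 - ∏ i, (x i / y i) ^ a i) := by rw [h1]; ring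
    _ ≤ (∏ i, x i ^ (-a i)) * ∑ i, (δ / x i) ^ ρ := by gcongr
    _ = _ := by
      rw [Finset.mul_sum, Finset.mul_sum]
      refine Finset.sum_congr rfl fun j _ => ?_
      rw [Real.div_rpow hδ (hx j).le, Real.rpow_neg (hx j).le]
      ring

lemma powKernel_eq_top {b : Fin 3 → ℝ} (hb : ∀ i, 0 < b i) {z : E3} {i : Fin 3} (hz : z i = 0) :
    powKernel b z = ⊤ := by
  unfold powKernel
  rw [← Finset.mul_prod_erase _ _ (Finset.mem_univ i), hz, enorm_zero,
    ENNReal.zero_rpow_of_neg (neg_lt_zero.2 (hb i)), ENNReal.top_mul]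
  refine Finset.prod_ne_zero_iff.2 fun j _ => ?_
  simp [ENNReal.rpow_eq_zero_iff, (hb j).le]

lemma powKernel_add_single (a : Fin 3 → ℝ) (ρ : ℝ) (j : Fin 3) {z : E3} (hz : ∀ i, z i ≠ 0) :
    powKernel (a + Pi.single j ρ) z
      = ENNReal.ofReal (|z j| ^ (-ρ) * ∏ i, |z i| ^ (-a i)) := by
  have hz' : ∀ i, 0 < |z i| := fun i => abs_pos.2 (hz i)
  have h : |z j| ^ (-ρ) = ∏ i, |z i| ^ (-(Pi.single j ρ : Fin 3 → ℝ) i) := by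
    rw [Finset.prod_eq_single j]
    · simp
    · intro i _ hi
      simp [hi]
    · simp
  rw [h, ← Finset.prod_mul_distrib, ENNReal.ofReal_prod_of_nonneg
    fun i _ => mul_nonneg (Real.rpow_nonneg (hz' i).le _) (Real.rpow_nonneg (hz' i).le _)]
  refine Finset.prod_congr rfl fun i _ => ?_
  rw [← Real.rpow_add (hz' i), ← ENNReal.ofReal_rpow_of_pos (hz' i), ← Real.norm_eq_abs,
    ofReal_norm, Pi.add_apply]
  congr 1
  ring

lemma ofReal_abs_prod_sub_prod_le {a : Fin 3 → ℝ} {δ ρ : ℝ} (hδ : 0 < δ) (ha0 : ∀ i, 0 < a i)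
    (ha : ∀ i, a i ≤ 1) (hρ : 0 ≤ ρ) (hρ1 : ρ ≤ 1) {u v : E3} (huv : ∀ i, |u i - v i| ≤ δ) :
    ENNReal.ofReal |∏ i, |u i| ^ (-a i) - ∏ i, |v i| ^ (-a i)|
      ≤ ENNReal.ofReal (δ ^ ρ) *
        ∑ j, (powKernel (a + Pi.single j ρ) u + powKernel (a + Pi.single j ρ) v) := by
  have hb : ∀ j i, 0 < (a + Pi.single j ρ : Fin 3 → ℝ) i := fun j i => by
    have : 0 ≤ (Pi.single j ρ : Fin 3 → ℝ) i := by
      rw [Pi.single_apply]; split_ifs <;> simp [hρ]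
    exact add_pos_of_pos_of_nonneg (ha0 i) this
  have hδρ : ENNReal.ofReal (δ ^ ρ) ≠ 0 := by
    simpa using Real.rpow_pos_of_pos hδ ρ
  by_cases hz : (∃ i, u i = 0) ∨ ∃ i, v i = 0
  · have htop : ∑ j, (powKernel (a + Pi.single j ρ) u + powKernel (a + Pi.single j ρ) v) = ⊤ := by
      refine ENNReal.sum_eq_top.2 ⟨0, Finset.mem_univ _, ?_⟩
      rcases hz with ⟨i, hi⟩ | ⟨i, hi⟩
      · rw [powKernel_eq_top (hb 0) hi, top_add]
      · rw [powKernel_eq_top (hb 0) hi, add_top]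
    rw [htop, ENNReal.mul_top hδρ]
    exact le_top
  push Not at hz
  obtain ⟨hu, hv⟩ := hz
  have huv' : ∀ i, |(|u i| - |v i|)| ≤ δ := fun i => (abs_abs_sub_abs_le _ _).trans (huv i)
  have hu' : ∀ i, 0 < |u i| := fun i => abs_pos.2 (hu i)
  have hv' : ∀ i, 0 < |v i| := fun i => abs_pos.2 (hv i)
  have hn : ∀ z : E3, ∀ j, 0 ≤ |z j| ^ (-ρ) * ∏ i, |z i| ^ (-a i) := fun z j =>
    mul_nonneg (by positivity) (Finset.prod_nonneg fun i _ => by positivity)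
  simp_rw [powKernel_add_single a ρ _ hu, powKernel_add_single a ρ _ hv,
    ← ENNReal.ofReal_add (hn _ _) (hn _ _)]
  rw [← ENNReal.ofReal_sum_of_nonneg fun j _ => add_nonneg (hn u j) (hn v j),
    ← ENNReal.ofReal_mul (by positivity)]
  refine ENNReal.ofReal_le_ofReal ?_
  have h1 := prod_rpow_sub_prod_rpow_le hu' hv' huv' (fun i => (ha0 i).le) ha hρ hρ1
  have h2 := prod_rpow_sub_prod_rpow_le hv' hu' (fun i => by rw [abs_sub_comm]; exact huv' i)
    (fun i => (ha0 i).le) ha hρ hρ1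
  have hs : ∀ z : E3, 0 ≤ δ ^ ρ * ∑ j, |z j| ^ (-ρ) * ∏ i, |z i| ^ (-a i) := fun z =>
    mul_nonneg (by positivity) (Finset.sum_nonneg fun j _ => hn z j)
  rw [Finset.sum_add_distrib, mul_add]
  exact abs_sub_le_iff.2 ⟨by linarith [hs v], by linarith [hs u]⟩

lemma fracKernel_eq_prod (H₁ H₂ H₃ : ℝ) (z : E3) :
    fracKernel H₁ H₂ H₃ z
      = ∏ i, |z i| ^ (-(![2 - 2 * H₁, 2 - 2 * H₂, 2 - 2 * H₃] : Fin 3 → ℝ) i) := by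
  simp [fracKernel, Fin.prod_univ_three]

lemma ofReal_mul_ofReal_rpow_le {s p B : ℝ} (hs : 0 < s) (hp : s ^ 2 ≤ p) (hB : 0 ≤ B) :
    ENNReal.ofReal s * ENNReal.ofReal p ^ (-B / 2) ≤ ENNReal.ofReal (s ^ (1 - B)) := by
  have hp0 : 0 < p := lt_of_lt_of_le (by positivity) hp
  rw [ENNReal.ofReal_rpow_of_pos hp0, ← ENNReal.ofReal_mul hs.le]
  refine ENNReal.ofReal_le_ofReal ?_
  calc s * p ^ (-B / 2) ≤ s * (s ^ 2) ^ (-B / 2) := by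
        exact mul_le_mul_of_nonneg_left
          (Real.rpow_le_rpow_of_nonpos (pow_pos hs 2) hp (by linarith)) hs.le
    _ = s ^ (1 - B) := by
        rw [← Real.rpow_natCast, ← Real.rpow_mul hs.le]
        nth_rewrite 1 [← Real.rpow_one s]
        rw [← Real.rpow_add hs]
        congr 1
        push_cast
        ring

lemma lintegral_const_mul_sum_add {ι α : Type*} [MeasurableSpace α] {μ : Measure α} (t : Finset ι)
    {F G : ι → α → ℝ≥0∞} (hF : ∀ j, Measurable (F j)) (hG : ∀ j, Measurable (G j)) (c : ℝ≥0∞) :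
    ∫⁻ x, c * ∑ j ∈ t, (F j x + G j x) ∂μ =
      c * ∑ j ∈ t, (∫⁻ x, F j x ∂μ + ∫⁻ x, G j x ∂μ) := by
  rw [lintegral_const_mul _ (by fun_prop), lintegral_finsetSum _ (fun j _ => by fun_prop)]
  congr 1
  exact Finset.sum_congr rfl fun j _ => lintegral_add_left (hF j) _

/-- Condition (4.1) of Theorem 4.1 for the fractional kernel: for
`0 < ρ₁ < min(2H₁-1, 2H₂-1, 2H₃-1, 2κ̄)` there is `C > 0` such that for all `0 < h ≤ 1`,
`∫₀^T ∫_{S²} ∫_{S²} |f(s(ξ+η)+h(ξ+η)) - f(s(ξ+η)+hη)| s σ(dξ) σ(dη) ds ≤ C h^{ρ₁}`. -/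
theorem frac_time_condition_one
    (H₁ H₂ H₃ κ T ρ₁ : ℝ)
    (h₁ : H₁ ∈ Set.Ioo (1/2 : ℝ) 1) (h₂ : H₂ ∈ Set.Ioo (1/2 : ℝ) 1)
    (h₃ : H₃ ∈ Set.Ioo (1/2 : ℝ) 1)
    (hsum : 2 < H₁ + H₂ + H₃) (hκ : κ = H₁ + H₂ + H₃ - 2) (hT : 0 < T)
    (hρ0 : 0 < ρ₁)
    (hρ1 : ρ₁ < min (2 * H₁ - 1) (min (2 * H₂ - 1) (min (2 * H₃ - 1) (2 * κ)))) :
    ∃ C : ℝ, 0 < C ∧ ∀ h : ℝ, 0 < h → h ≤ 1 →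
      (∫⁻ s in Set.Ioc (0 : ℝ) T, ∫⁻ ξ, ∫⁻ η,
          ENNReal.ofReal
            (|fracKernel H₁ H₂ H₃ (s • (ξ + η) + h • (ξ + η))
                - fracKernel H₁ H₂ H₃ (s • (ξ + η) + h • η)| * s)
        ∂sphereMeasure ∂sphereMeasure)
      ≤ ENNReal.ofReal (C * h ^ ρ₁) := by
  rw [lt_min_iff, lt_min_iff, lt_min_iff] at hρ1
  obtain ⟨hρH₁, hρH₂, hρH₃, hρκ⟩ := hρ1
  obtain ⟨h₁l, h₁u⟩ := h₁
  obtain ⟨h₂l, h₂u⟩ := h₂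
  obtain ⟨h₃l, h₃u⟩ := h₃
  set a : Fin 3 → ℝ := ![2 - 2 * H₁, 2 - 2 * H₂, 2 - 2 * H₃] with ha
  set B : ℝ := ∑ i, a i + ρ₁ with hB
  have hsuma : ∑ i, a i = 6 - 2 * (H₁ + H₂ + H₃) := by
    rw [Fin.sum_univ_three]; simp [ha]; ring
  have ha0 : ∀ i, 0 < a i := by intro i; fin_cases i <;> simp [ha] <;> linarith
  have haρ : ∀ i, a i + ρ₁ < 1 := by intro i; fin_cases i <;> simp [ha] <;> linarith
  have hB2 : B < 2 := by rw [hB, hsuma]; linarith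
  have hB0 : 0 ≤ B := add_nonneg (Finset.sum_nonneg fun i _ => (ha0 i).le) hρ0.le
  have hsingle : ∀ j i : Fin 3, 0 ≤ (Pi.single j ρ₁ : Fin 3 → ℝ) i ∧
      (Pi.single j ρ₁ : Fin 3 → ℝ) i ≤ ρ₁ := fun j i => by
    rw [Pi.single_apply]; split_ifs <;> simp [hρ0.le]
  have hbsum : ∀ j, ∑ i, (a + Pi.single j ρ₁ : Fin 3 → ℝ) i = B := fun j => by
    simp [Finset.sum_add_distrib, hB]
  have hD := fun j : Fin 3 => exists_lintegral_lintegral_powKernel_le (b := a + Pi.single j ρ₁)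
    (fun i => add_pos_of_pos_of_nonneg (ha0 i) (hsingle j i).1)
    (fun i => (add_le_add_right (hsingle j i).2 (a i)).trans_lt (haρ i))
    ((hbsum j).trans_lt hB2)
  simp_rw [hbsum] at hD
  choose D hDtop hDle using hD
  have hI : ∫⁻ s in Set.Ioc (0 : ℝ) T, ENNReal.ofReal (s ^ (1 - B)) ≠ ⊤ := by
    have := (intervalIntegral.intervalIntegrable_rpow' (a := 0) (b := T) (r := 1 - B)
      (by linarith)).1
    exact this.lintegral_lt_top.ne
  set E : ℝ≥0∞ := (∑ j, (D j + D j)) * ∫⁻ s in Set.Ioc (0 : ℝ) T, ENNReal.ofReal (s ^ (1 - B))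
    with hE
  have hEtop : E ≠ ⊤ := ENNReal.mul_ne_top
    (ENNReal.sum_ne_top.2 fun j _ => ENNReal.add_ne_top.2 ⟨hDtop j, hDtop j⟩) hI
  refine ⟨E.toReal + 1, by positivity, fun h hh _ => ?_⟩
  have hkey : ∀ s ∈ Set.Ioc (0 : ℝ) T,
      ∫⁻ ξ, ∫⁻ η, ENNReal.ofReal
            (|fracKernel H₁ H₂ H₃ (s • (ξ + η) + h • (ξ + η))
                - fracKernel H₁ H₂ H₃ (s • (ξ + η) + h • η)| * s)
        ∂sphereMeasure ∂sphereMeasure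
      ≤ ENNReal.ofReal (h ^ ρ₁) * (∑ j, (D j + D j)) * ENNReal.ofReal (s ^ (1 - B)) := by
    rintro s ⟨hs, -⟩
    have hsh : 0 < s + h := by linarith
    have hm : ∀ (j : Fin 3) (α β : ℝ), Measurable fun p : E3 × E3 =>
        powKernel (a + Pi.single j ρ₁) (α • p.1 + β • p.2) := fun j α β => by fun_prop
    have hm1 : ∀ (j : Fin 3) (α β : ℝ) (ξ : E3), Measurable fun η : E3 =>
        powKernel (a + Pi.single j ρ₁) (α • ξ + β • η) := fun j α β ξ => by fun_prop
    have hm2 : ∀ (j : Fin 3) (α β : ℝ), Measurable fun ξ : E3 =>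
        ∫⁻ η, powKernel (a + Pi.single j ρ₁) (α • ξ + β • η) ∂sphereMeasure :=
      fun j α β => (hm j α β).lintegral_prod_right'
    calc _ ≤ ∫⁻ ξ, ∫⁻ η, (ENNReal.ofReal (h ^ ρ₁) * ENNReal.ofReal s) *
          ∑ j, (powKernel (a + Pi.single j ρ₁) ((s + h) • ξ + (s + h) • η)
            + powKernel (a + Pi.single j ρ₁) (s • ξ + (s + h) • η))
          ∂sphereMeasure ∂sphereMeasure := by
          refine lintegral_mono_ae ?_
          filter_upwards [ae_norm_eq_one] with ξ hξ
          refine lintegral_mono fun η => ?_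
          have e1 : s • (ξ + η) + h • (ξ + η) = (s + h) • ξ + (s + h) • η := by module
          have e2 : s • (ξ + η) + h • η = s • ξ + (s + h) • η := by module
          rw [e1, e2, fracKernel_eq_prod, fracKernel_eq_prod, ← ha,
            ENNReal.ofReal_mul (abs_nonneg _), mul_right_comm]
          gcongr
          refine ofReal_abs_prod_sub_prod_le hh ha0 (fun i => by linarith [haρ i]) hρ0.le
            (by linarith) fun i => ?_
          have e3 : ((s + h) • ξ + (s + h) • η) i - (s • ξ + (s + h) • η) i = h * ξ i := by
            simp; ring
          rw [e3, abs_mul, abs_of_pos hh]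
          have := PiLp.norm_apply_le ξ i
          rw [hξ, Real.norm_eq_abs] at this
          exact mul_le_of_le_one_right hh.le this
      _ = (ENNReal.ofReal (h ^ ρ₁) * ENNReal.ofReal s) *
          ∑ j, (∫⁻ ξ, ∫⁻ η, powKernel (a + Pi.single j ρ₁) ((s + h) • ξ + (s + h) • η)
              ∂sphereMeasure ∂sphereMeasure
            + ∫⁻ ξ, ∫⁻ η, powKernel (a + Pi.single j ρ₁) (s • ξ + (s + h) • η)
              ∂sphereMeasure ∂sphereMeasure) := by
          have i1 : ∀ ξ : E3, ∫⁻ η, (ENNReal.ofReal (h ^ ρ₁) * ENNReal.ofReal s) *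
              ∑ j, (powKernel (a + Pi.single j ρ₁) ((s + h) • ξ + (s + h) • η)
                + powKernel (a + Pi.single j ρ₁) (s • ξ + (s + h) • η)) ∂sphereMeasure
              = (ENNReal.ofReal (h ^ ρ₁) * ENNReal.ofReal s) *
              ∑ j, (∫⁻ η, powKernel (a + Pi.single j ρ₁) ((s + h) • ξ + (s + h) • η) ∂sphereMeasure
                + ∫⁻ η, powKernel (a + Pi.single j ρ₁) (s • ξ + (s + h) • η) ∂sphereMeasure) := by
            exact fun ξ => lintegral_const_mul_sum_add _ (fun j => hm1 j _ _ ξ)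
              (fun j => hm1 j _ _ ξ) _
          simp_rw [i1]
          exact lintegral_const_mul_sum_add _ (fun j => hm2 j _ _) (fun j => hm2 j _ _) _
      _ ≤ (ENNReal.ofReal (h ^ ρ₁) * ENNReal.ofReal s) *
          ∑ j, (D j * ENNReal.ofReal ((s + h) * (s + h)) ^ (-B / 2)
            + D j * ENNReal.ofReal (s * (s + h)) ^ (-B / 2)) := by
          gcongr with j _
          · exact hDle j _ _ hsh hsh
          · exact hDle j _ _ hs hsh
      _ = ENNReal.ofReal (h ^ ρ₁) *
          ∑ j, (D j * (ENNReal.ofReal s * ENNReal.ofReal ((s + h) * (s + h)) ^ (-B / 2))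
            + D j * (ENNReal.ofReal s * ENNReal.ofReal (s * (s + h)) ^ (-B / 2))) := by
          rw [mul_assoc, Finset.mul_sum]
          congr 1
          exact Finset.sum_congr rfl fun j _ => by ring
      _ ≤ ENNReal.ofReal (h ^ ρ₁) *
          ∑ j, (D j * ENNReal.ofReal (s ^ (1 - B)) + D j * ENNReal.ofReal (s ^ (1 - B))) := by
          gcongr with j _
          · exact ofReal_mul_ofReal_rpow_le hs (by nlinarith) hB0
          · exact ofReal_mul_ofReal_rpow_le hs (by nlinarith) hB0
      _ = _ := by
          rw [mul_assoc, Finset.sum_mul]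
          simp_rw [add_mul]
  calc _ ≤ ∫⁻ s in Set.Ioc (0 : ℝ) T,
        ENNReal.ofReal (h ^ ρ₁) * (∑ j, (D j + D j)) * ENNReal.ofReal (s ^ (1 - B)) :=
        setLIntegral_mono' measurableSet_Ioc hkey
    _ = ENNReal.ofReal (h ^ ρ₁) * E := by
        rw [lintegral_const_mul _ (by fun_prop), mul_assoc]
    _ ≤ ENNReal.ofReal (h ^ ρ₁) * ENNReal.ofReal (E.toReal + 1) := by
        gcongr
        rw [← ENNReal.ofReal_toReal hEtop]
        exact ENNReal.ofReal_le_ofReal (by rw [ENNReal.ofReal_toReal hEtop]; linarith)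
    _ = _ := by
        rw [mul_comm, ENNReal.ofReal_mul (by positivity)]
end
end

section
/- Let H₁, H₂, H₃ ∈ (1/2, 1) with H₁ + H₂ + H₃ > 2 and set κ̄ = H₁ + H₂ + H₃ − 2. Define ψ(h) = ∫_{ℝ³} (h − sin(2h|ξ|)/(2|ξ|)) |ξ|⁻² |ξ₁|^{1−2H₁}|ξ₂|^{1−2H₂}|ξ₃|^{1−2H₃} dξ for h > 0. Then 0 < ψ(1) < ∞ and ψ(h) = h^{2κ̄+1} ψ(1) for every h > 0; in particular there exist constants c₁, c₂ > 0 with c₁ h^{2κ̄+1} ≤ ψ(h) ≤ c₂ h^{2κ̄+1} for all h > 0. -/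
open MeasureTheory Real
open scoped ENNReal

noncomputable section

/-- `ψ(h) = ∫_{ℝ³} (h - sin(2h|ξ|)/(2|ξ|)) |ξ|⁻² |ξ₁|^{1-2H₁}|ξ₂|^{1-2H₂}|ξ₃|^{1-2H₃} dξ`,
the (nonnegative) integrand being integrated in `[0,∞]`. -/
def psiTime (H₁ H₂ H₃ : ℝ) (h : ℝ) : ℝ≥0∞ :=
  ∫⁻ ξ : E3, ENNReal.ofReal
    ((h - Real.sin (2 * h * ‖ξ‖) / (2 * ‖ξ‖)) * (‖ξ‖ ^ 2)⁻¹
      * (|ξ 0| ^ (1 - 2 * H₁) * |ξ 1| ^ (1 - 2 * H₂) * |ξ 2| ^ (1 - 2 * H₃)))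

theorem one_sub_sin_div_mul_le {r : ℝ} (hr : 0 ≤ r) :
    (1 - Real.sin (2 * 1 * r) / (2 * r)) * (r ^ 2)⁻¹ ≤ 4 * (1 + r ^ 2)⁻¹ := by
  rcases hr.eq_or_lt with rfl | hr
  · simp
  rw [mul_one, ← div_eq_mul_inv, ← div_eq_mul_inv, div_le_div_iff₀ (by positivity) (by positivity)]
  set u := 1 - Real.sin (2 * r) / (2 * r) with hu
  have hu₁ : u ≤ 2 := by
    have h := Real.neg_one_le_sin (2 * r)
    have h' : -Real.sin (2 * r) ≤ 2 * r := by
      have := Real.abs_sin_le_abs (x := 2 * r)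
      rw [abs_of_pos (by positivity : 0 < 2 * r)] at this
      exact (neg_le_abs _).trans this
    have : -1 ≤ Real.sin (2 * r) / (2 * r) := by
      rw [le_div_iff₀ (by positivity)]
      linarith
    linarith
  have hu₂ : u ≤ r ^ 2 := by
    have h := Real.sin_gt_sub_cube (x := 2 * r) (by positivity)
    have : 1 - r ^ 2 ≤ Real.sin (2 * r) / (2 * r) := by
      rw [le_div_iff₀ (by positivity)]
      nlinarith [pow_pos hr 3]
    linarith
  nlinarith [sq_nonneg r, mul_le_mul_of_nonneg_right hu₁ (sq_nonneg r)]

theorem integrable_abs_rpow_mul_one_add_sq_rpow {a p : ℝ} (ha : -1 < a) (hp : 0 ≤ p)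
    (hap : a - 2 * p < -1) :
    Integrable (fun x : ℝ => |x| ^ a * (1 + x ^ 2) ^ (-p)) := by
  have hmeas : Measurable (fun x : ℝ => x ^ a * (1 + x ^ 2) ^ (-p)) := by fun_prop
  have key : IntegrableOn (fun x : ℝ => x ^ a * (1 + x ^ 2) ^ (-p)) (Set.Ioi 0) := by
    rw [← Set.Ioc_union_Ioi_eq_Ioi (zero_le_one (α := ℝ))]
    refine IntegrableOn.union ?_ ?_
    · have h := intervalIntegral.intervalIntegrable_rpow' (a := 0) (b := 1) ha
      rw [intervalIntegrable_iff_integrableOn_Ioc_of_le zero_le_one] at h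
      refine h.mono' hmeas.aestronglyMeasurable ?_
      filter_upwards [ae_restrict_mem measurableSet_Ioc] with x hx
      have hx0 : 0 < x := hx.1
      rw [Real.norm_of_nonneg (by positivity)]
      refine mul_le_of_le_one_right (by positivity) ?_
      exact Real.rpow_le_one_of_one_le_of_nonpos (by nlinarith [sq_nonneg x]) (neg_nonpos.2 hp)
    · refine (integrableOn_Ioi_rpow_of_lt hap zero_lt_one).mono' hmeas.aestronglyMeasurable ?_
      filter_upwards [ae_restrict_mem measurableSet_Ioi] with x hx
      have hx0 : 0 < x := zero_lt_one.trans hx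
      rw [Real.norm_of_nonneg (by positivity)]
      have h : (1 + x ^ 2) ^ (-p) ≤ (x ^ 2) ^ (-p) :=
        Real.rpow_le_rpow_of_nonpos (by positivity) (by linarith) (neg_nonpos.2 hp)
      calc x ^ a * (1 + x ^ 2) ^ (-p) ≤ x ^ a * (x ^ 2) ^ (-p) := by gcongr
        _ = x ^ (a - 2 * p) := by
          rw [← Real.rpow_natCast x 2, ← Real.rpow_mul hx0.le, ← Real.rpow_add hx0]
          congr 1
          push_cast
          ring
  have h := (integrable_fun_norm_addHaar (volume : Measure ℝ)
    (f := fun x : ℝ => x ^ a * (1 + x ^ 2) ^ (-p))).2 (by simpa using key)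
  simpa only [Real.norm_eq_abs, sq_abs] using h

/-- The product weight splits `(1 + |ξ|²)⁻¹` into one-dimensional factors. -/
theorem inv_one_add_norm_sq_le_prod (ξ : E3) {p : Fin 3 → ℝ} (hp : ∀ i, 0 ≤ p i)
    (hsum : ∑ i, p i = 1) :
    (1 + ‖ξ‖ ^ 2)⁻¹ ≤ ∏ i, (1 + ξ i ^ 2) ^ (-p i) := by
  have hpos : 0 < 1 + ‖ξ‖ ^ 2 := by positivity
  calc (1 + ‖ξ‖ ^ 2)⁻¹ = ∏ i, (1 + ‖ξ‖ ^ 2) ^ (-p i) := by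
        rw [← Real.rpow_sum_of_pos hpos, Finset.sum_neg_distrib, hsum, Real.rpow_neg_one]
    _ ≤ _ := by
        refine Finset.prod_le_prod (fun i _ => by positivity) fun i _ => ?_
        refine Real.rpow_le_rpow_of_nonpos (by positivity) ?_ (by linarith [hp i])
        have := PiLp.norm_apply_le ξ i
        rw [← sq_abs (ξ i), ← Real.norm_eq_abs]
        gcongr

theorem psiTime_integrand_measurable (H₁ H₂ H₃ h : ℝ) :
    Measurable fun ξ : E3 => ENNReal.ofReal
      ((h - Real.sin (2 * h * ‖ξ‖) / (2 * ‖ξ‖)) * (‖ξ‖ ^ 2)⁻¹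
        * (|ξ 0| ^ (1 - 2 * H₁) * |ξ 1| ^ (1 - 2 * H₂) * |ξ 2| ^ (1 - 2 * H₃))) := by
  have hc (i : Fin 3) : Measurable fun ξ : E3 => |ξ i| := by fun_prop
  have h0 := hc 0
  have h1 := hc 1
  have h2 := hc 2
  fun_prop

theorem psiTime_one_lt_top {H₁ H₂ H₃ : ℝ}
    (h₁ : H₁ ∈ Set.Ioo (1/2 : ℝ) 1) (h₂ : H₂ ∈ Set.Ioo (1/2 : ℝ) 1)
    (h₃ : H₃ ∈ Set.Ioo (1/2 : ℝ) 1) (hsum : 2 < H₁ + H₂ + H₃) :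
    psiTime H₁ H₂ H₃ 1 < ∞ := by
  let H : Fin 3 → ℝ := ![H₁, H₂, H₃]
  have hH : ∀ i, H i ∈ Set.Ioo (1/2 : ℝ) 1 := by
    intro i
    fin_cases i <;> assumption
  let p : Fin 3 → ℝ := fun i => 1 - H i + (H₁ + H₂ + H₃ - 2) / 3
  have hp : ∀ i, 0 ≤ p i := fun i => by
    have := (hH i).2
    simp only [p]
    linarith
  have hpsum : ∑ i, p i = 1 := by
    simp only [Fin.sum_univ_three, p, H, Matrix.cons_val]
    ring
  have hint : Integrable (fun ξ : E3 => ∏ i, |ξ i| ^ (1 - 2 * H i) * (1 + ξ i ^ 2) ^ (-p i)) := by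
    have hpi : Integrable
        (fun x : Fin 3 → ℝ => ∏ i, |x i| ^ (1 - 2 * H i) * (1 + x i ^ 2) ^ (-p i)) :=
      Integrable.fintype_prod (𝕜 := ℝ) (μ := fun _ : Fin 3 => (volume : Measure ℝ))
        (f := fun i x => |x| ^ (1 - 2 * H i) * (1 + x ^ 2) ^ (-p i)) fun i => by
        have := (hH i).2
        refine integrable_abs_rpow_mul_one_add_sq_rpow (by linarith) (hp i) ?_
        simp only [p]
        linarith
    exact (PiLp.volume_preserving_ofLp (Fin 3)).integrable_comp_of_integrable hpi
  refine lt_of_le_of_lt (lintegral_mono fun ξ => ENNReal.ofReal_le_ofReal ?_)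
    (hint.const_mul 4).lintegral_lt_top
  have hb : (1 - Real.sin (2 * 1 * ‖ξ‖) / (2 * ‖ξ‖)) * (‖ξ‖ ^ 2)⁻¹
      ≤ 4 * ∏ i, (1 + ξ i ^ 2) ^ (-p i) :=
    (one_sub_sin_div_mul_le (norm_nonneg ξ)).trans
      (by gcongr; exact inv_one_add_norm_sq_le_prod ξ hp hpsum)
  refine (mul_le_mul_of_nonneg_right hb (by positivity)).trans_eq ?_
  simp only [Fin.prod_univ_three, H, Matrix.cons_val]
  ring

theorem psiTime_one_pos (H₁ H₂ H₃ : ℝ) : 0 < psiTime H₁ H₂ H₃ 1 := by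
  rw [psiTime, lintegral_pos_iff_support (psiTime_integrand_measurable H₁ H₂ H₃ 1)]
  have hopen : IsOpen (⋂ i : Fin 3, {ξ : E3 | 0 < ξ i}) :=
    isOpen_iInter_of_finite fun i => isOpen_lt continuous_const (by fun_prop)
  have hne : (⋂ i : Fin 3, {ξ : E3 | 0 < ξ i}).Nonempty :=
    ⟨WithLp.toLp 2 fun _ => 1, by simp⟩
  refine (hopen.measure_pos volume hne).trans_le (measure_mono fun ξ hξ => ?_)
  rw [Set.mem_iInter] at hξ
  have h0 : 0 < ξ 0 := hξ 0
  have h1 : 0 < ξ 1 := hξ 1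
  have h2 : 0 < ξ 2 := hξ 2
  have hr : 0 < ‖ξ‖ := norm_pos_iff.2 fun h => by simp [h] at h0
  have hs : 0 < 1 - Real.sin (2 * 1 * ‖ξ‖) / (2 * ‖ξ‖) := by
    rw [sub_pos, mul_one, div_lt_one (by positivity)]
    exact Real.sin_lt (by positivity)
  rw [Function.mem_support]
  exact (ENNReal.ofReal_pos.2 (by positivity)).ne'

theorem lintegral_comp_smul_of_pos {E : Type*} [NormedAddCommGroup E] [NormedSpace ℝ E]
    [MeasurableSpace E] [BorelSpace E] [FiniteDimensional ℝ E] (μ : Measure E)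
    [μ.IsAddHaarMeasure] {f : E → ℝ≥0∞} (hf : Measurable f) {r : ℝ} (hr : 0 < r) :
    ∫⁻ x, f (r • x) ∂μ = ENNReal.ofReal ((r ^ Module.finrank ℝ E)⁻¹) * ∫⁻ x, f x ∂μ := by
  rw [← lintegral_map hf (measurable_const_smul r), Measure.map_addHaar_smul μ hr.ne',
    lintegral_smul_measure, abs_of_pos (by positivity), smul_eq_mul]

theorem psiTime_eq_rpow_mul {H₁ H₂ H₃ κ h : ℝ} (hκ : κ = H₁ + H₂ + H₃ - 2) (hh : 0 < h) :
    psiTime H₁ H₂ H₃ h = ENNReal.ofReal (h ^ (2 * κ + 1)) * psiTime H₁ H₂ H₃ 1 := by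
  have hpow : h ^ (2 * κ + 4) * (h ^ (1 - 2 * H₁) * h ^ (1 - 2 * H₂) * h ^ (1 - 2 * H₃))
      = h ^ 3 := by
    rw [← Real.rpow_natCast h 3]
    simp only [← Real.rpow_add hh]
    congr 1
    rw [hκ]
    push_cast
    ring
  have hmeas := psiTime_integrand_measurable H₁ H₂ H₃ 1
  have hfac : ENNReal.ofReal (h ^ (2 * κ + 1))
      = ENNReal.ofReal (h ^ (2 * κ + 4)) * ENNReal.ofReal ((h ^ Module.finrank ℝ E3)⁻¹) := by
    rw [← ENNReal.ofReal_mul (by positivity), finrank_euclideanSpace_fin,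
      ← Real.rpow_natCast h 3, ← Real.rpow_neg hh.le, ← Real.rpow_add hh]
    congr 2
    push_cast
    ring
  rw [hfac, mul_assoc, psiTime, psiTime, ← lintegral_comp_smul_of_pos volume hmeas hh,
    ← lintegral_const_mul' _ _ ENNReal.ofReal_ne_top]
  refine lintegral_congr fun ξ => ?_
  rw [← ENNReal.ofReal_mul (by positivity)]
  congr 1
  simp only [norm_smul, Real.norm_of_nonneg hh.le, PiLp.smul_apply, smul_eq_mul, abs_mul,
    abs_of_pos hh, Real.mul_rpow hh.le (abs_nonneg _), mul_one, ← mul_assoc (2 : ℝ) h]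
  have hkernel : h - Real.sin (2 * h * ‖ξ‖) / (2 * ‖ξ‖)
      = h * (1 - Real.sin (2 * h * ‖ξ‖) / (2 * h * ‖ξ‖)) := by
    rcases (norm_nonneg ξ).eq_or_lt with hr | hr
    · simp [← hr]
    · field_simp
  rw [hkernel]
  generalize 1 - Real.sin (2 * h * ‖ξ‖) / (2 * h * ‖ξ‖) = k
  generalize |ξ 0| ^ (1 - 2 * H₁) = x
  generalize |ξ 1| ^ (1 - 2 * H₂) = y
  generalize |ξ 2| ^ (1 - 2 * H₃) = z
  calc h * k * (‖ξ‖ ^ 2)⁻¹ * (x * y * z)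
      = h ^ 3 * (k * ((h * ‖ξ‖) ^ 2)⁻¹ * (x * y * z)) := by
        rw [mul_pow, mul_inv]
        field_simp
    _ = _ := by
        rw [← hpow]
        ring

/-- Scaling identity from the proof of Theorem 6.2(b): `0 < ψ(1) < ∞` and
`ψ(h) = h^{2κ̄+1} ψ(1)` for all `h > 0`; in particular
`c₁ h^{2κ̄+1} ≤ ψ(h) ≤ c₂ h^{2κ̄+1}` for some `c₁, c₂ > 0` and all `h > 0`. -/
theorem frac_time_scaling
    (H₁ H₂ H₃ κ : ℝ)
    (h₁ : H₁ ∈ Set.Ioo (1/2 : ℝ) 1) (h₂ : H₂ ∈ Set.Ioo (1/2 : ℝ) 1)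
    (h₃ : H₃ ∈ Set.Ioo (1/2 : ℝ) 1)
    (hsum : 2 < H₁ + H₂ + H₃) (hκ : κ = H₁ + H₂ + H₃ - 2) :
    0 < psiTime H₁ H₂ H₃ 1 ∧ psiTime H₁ H₂ H₃ 1 < ∞ ∧
    (∀ h : ℝ, 0 < h →
        psiTime H₁ H₂ H₃ h = ENNReal.ofReal (h ^ (2 * κ + 1)) * psiTime H₁ H₂ H₃ 1) ∧
    ∃ c₁ c₂ : ℝ, 0 < c₁ ∧ 0 < c₂ ∧ ∀ h : ℝ, 0 < h →
        ENNReal.ofReal (c₁ * h ^ (2 * κ + 1)) ≤ psiTime H₁ H₂ H₃ h ∧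
        psiTime H₁ H₂ H₃ h ≤ ENNReal.ofReal (c₂ * h ^ (2 * κ + 1)) := by
  have hpos := psiTime_one_pos H₁ H₂ H₃
  have hfin := psiTime_one_lt_top h₁ h₂ h₃ hsum
  have hc : 0 < (psiTime H₁ H₂ H₃ 1).toReal := ENNReal.toReal_pos hpos.ne' hfin.ne
  refine ⟨hpos, hfin, fun h hh => psiTime_eq_rpow_mul hκ hh, _, _, hc, hc, fun h hh => ?_⟩
  have heq : psiTime H₁ H₂ H₃ h
      = ENNReal.ofReal ((psiTime H₁ H₂ H₃ 1).toReal * h ^ (2 * κ + 1)) := by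
    rw [psiTime_eq_rpow_mul hκ hh, ENNReal.ofReal_mul hc.le, ENNReal.ofReal_toReal hfin.ne,
      mul_comm]
  exact ⟨heq.ge, heq.le⟩
end
end
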